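/- arXiv:2212.08808 — 2 statements merged into one kernel-verified Lean document; each statement's English description precedes it below -/
import Mathlib

section
/- Given any influence network G(W) on node set V and any initial state x(0) ∈ ℝ^n, there exist T ∈ ℕ and a finite update sequence i_1, …, i_T in V such that the trajectory x(t) of the weighted-median opinion dynamics along this update sequence satisfies that x(T) is an equilibrium. -/
open Finset MeasureTheory

/-- `m` is a weighted median of `x` associated with the weights `w`. -/
def IsWMedian {V : Type*} [Fintype V] (x w : V → ℝ) (m : ℝ) : Prop :=
  (∃ i, x i = m) ∧
    (∑ i ∈ Finset.univ.filter (fun i => x i < m), w i) ≤ 1 / 2 ∧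
    (∑ i ∈ Finset.univ.filter (fun i => m < x i), w i) ≤ 1 / 2

/-- `W` is a row-stochastic matrix. -/
def RowStochastic {V : Type*} [Fintype V] (W : V → V → ℝ) : Prop :=
  (∀ i j, 0 ≤ W i j) ∧ ∀ i, ∑ j, W i j = 1

open Classical in
/-- `Med W x i` : the weighted median of `x` w.r.t. the weights of row `i` of `W`;
if it is not unique, the weighted median closest to `x i`. -/
noncomputable def Med {V : Type*} [Fintype V] (W : V → V → ℝ) (x : V → ℝ) (i : V) : ℝ :=
  if h : ∃ m, IsWMedian x (W i) m ∧ ∀ m', IsWMedian x (W i) m' → |m - x i| ≤ |m' - x i| then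
    h.choose
  else x i

/-- Trajectory of the weighted-median opinion dynamics: at step `t → t+1` the node `u t`
updates its opinion to its weighted median, all other opinions stay unchanged. -/
noncomputable def traj {V : Type*} [Fintype V] [DecidableEq V]
    (W : V → V → ℝ) (u : ℕ → V) (x0 : V → ℝ) : ℕ → V → ℝ
  | 0 => x0
  | t + 1 => Function.update (traj W u x0 t) (u t) (Med W (traj W u x0 t) (u t))

def IsEquilibrium {V : Type*} [Fintype V] (W : V → V → ℝ) (x : V → ℝ) : Prop :=
  ∀ i, Med W x i = x i

/-- `M` is a cohesive set. -/
def Cohesive {V : Type*} [Fintype V] (W : V → V → ℝ) (M : Finset V) : Prop :=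
  ∀ i ∈ M, 1 / 2 ≤ ∑ j ∈ M, W i j

/-- `M` is a maximal cohesive set. -/
def MaxCohesive {V : Type*} [Fintype V] (W : V → V → ℝ) (M : Finset V) : Prop :=
  Cohesive W M ∧ ∀ i ∉ M, ¬ (1 / 2 < ∑ j ∈ M, W i j)

/-- One step of the cohesive-expansion process: add one node `i` outside the current
set whose total weight on the current set exceeds 1/2. -/
def ExpStep {V : Type*} [Fintype V] [DecidableEq V] (W : V → V → ℝ) (A B : Finset V) : Prop :=
  ∃ i ∉ A, 1 / 2 < ∑ j ∈ A, W i j ∧ B = insert i A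

/-- `E` is a cohesive expansion of `M`: obtained from `M` by repeatedly adding nodes,
until no further node can be added. -/
def IsExpansion {V : Type*} [Fintype V] [DecidableEq V] (W : V → V → ℝ) (M E : Finset V) : Prop :=
  Relation.ReflTransGen (ExpStep W) M E ∧ ∀ i ∉ E, ¬ (1 / 2 < ∑ j ∈ E, W i j)

/-- `(i,j)` is a decisive out-link of `i`. -/
def Decisive {V : Type*} [Fintype V] [DecidableEq V] (W : V → V → ℝ) (i j : V) : Prop :=
  ∃ θ : Finset V, (∀ k ∈ θ, W i k ≠ 0) ∧ j ∈ θ ∧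
    1 / 2 < ∑ k ∈ θ, W i k ∧ (∑ k ∈ θ.erase j, W i k) < 1 / 2

/-- `μ` is the law of the i.i.d. uniform random update sequence, characterized via its
finite-dimensional cylinder probabilities. -/
def IIDUniform {n : ℕ} (μ : Measure (ℕ → Fin n)) : Prop :=
  IsProbabilityMeasure μ ∧
    ∀ (s : Finset ℕ) (g : ℕ → Fin n),
      μ {u | ∀ t ∈ s, u t = g t} = (1 / (n : ENNReal)) ^ s.card

section WeightedMedian

variable {V : Type*} [Fintype V]

theorem exists_isWMedian [Nonempty V] (x w : V → ℝ) (hw : ∀ i, 0 ≤ w i)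
    (hw1 : ∑ i, w i = 1) : ∃ m, IsWMedian x w m := by
  classical
  let S : Finset V := univ.filter fun i => ∑ j ∈ univ.filter (fun j => x i < x j), w j ≤ 1 / 2
  have hS : S.Nonempty := by
    obtain ⟨i, -, hi⟩ := exists_max_image (univ : Finset V) x univ_nonempty
    refine ⟨i, mem_filter.2 ⟨mem_univ _, ?_⟩⟩
    rw [filter_false_of_mem fun j hj => not_lt.2 (hi j hj)]
    norm_num
  obtain ⟨i, hiS, hmin⟩ := exists_min_image S x hS
  refine ⟨x i, ⟨i, rfl⟩, ?_, (mem_filter.1 hiS).2⟩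
  by_contra! hlt
  have hne : (univ.filter fun j => x j < x i).Nonempty := by
    by_contra hempty
    rw [not_nonempty_iff_eq_empty.1 hempty] at hlt
    norm_num at hlt
  obtain ⟨p, hp, hmax⟩ := exists_max_image _ x hne
  have hpi : x p < x i := (mem_filter.1 hp).2
  have hsplit := sum_filter_add_sum_filter_not univ (fun j => x j < x i) w
  have hle : ∑ j ∈ univ.filter (fun j => x p < x j), w j ≤
      ∑ j ∈ univ.filter (fun j => ¬ x j < x i), w j := by
    refine sum_le_sum_of_subset_of_nonneg (fun j hj => ?_) fun j _ _ => hw j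
    simp only [mem_filter, mem_univ, true_and] at hj ⊢
    exact fun hji => (hmax j (by simpa using hji)).not_gt hj
  have hpS : p ∈ S := mem_filter.2 ⟨mem_univ _, by linarith⟩
  exact (hmin p hpS).not_gt hpi

variable {W : V → V → ℝ}

theorem Med_spec (hW : RowStochastic W) (x : V → ℝ) (i : V) :
    IsWMedian x (W i) (Med W x i) ∧
      ∀ m, IsWMedian x (W i) m → |Med W x i - x i| ≤ |m - x i| := by
  classical
  have : Nonempty V := ⟨i⟩
  have hex : ∃ m, IsWMedian x (W i) m ∧
      ∀ m', IsWMedian x (W i) m' → |m - x i| ≤ |m' - x i| := by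
    have hfin : {m | IsWMedian x (W i) m}.Finite :=
      (Set.finite_range x).subset fun m hm => hm.1
    exact Set.exists_min_image _ (fun m => |m - x i|) hfin
      (exists_isWMedian x (W i) (hW.1 i) (hW.2 i))
  rw [Med, dif_pos hex]
  exact hex.choose_spec

theorem Med_le_iff (hW : RowStochastic W) (x : V → ℝ) (i : V) :
    Med W x i ≤ x i ↔ ∑ j ∈ univ.filter (fun j => x i < x j), W i j ≤ 1 / 2 := by
  obtain ⟨⟨-, hlow, hupp⟩, hclosest⟩ := Med_spec hW x i
  constructor
  · intro hle
    refine le_trans (sum_le_sum_of_subset_of_nonneg ?_ fun j _ _ => hW.1 i j) hupp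
    exact monotone_filter_right _ fun j _ hj => hle.trans_lt hj
  · intro hsum
    by_contra! hlt
    have hmed : IsWMedian x (W i) (x i) := by
      refine ⟨⟨i, rfl⟩, le_trans
        (sum_le_sum_of_subset_of_nonneg ?_ fun j _ _ => hW.1 i j) hlow, hsum⟩
      exact monotone_filter_right _ fun j _ hj => hj.trans hlt
    have hdist := hclosest _ hmed
    rw [sub_self, abs_zero, abs_nonpos_iff, sub_eq_zero] at hdist
    exact hlt.ne' hdist

variable [DecidableEq V]

/-- If no node wants to raise its opinion, then this remains so after any update. -/
theorem Med_update_le (hW : RowStochastic W) {x : V → ℝ} (hx : ∀ k, Med W x k ≤ x k) (i k : V) :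
    Med W (Function.update x i (Med W x i)) k ≤ Function.update x i (Med W x i) k := by
  have hle : Function.update x i (Med W x i) ≤ x := update_le_self_iff.2 (hx i)
  rw [Med_le_iff hW]
  rcases eq_or_ne k i with rfl | hki
  · refine le_trans (sum_le_sum_of_subset_of_nonneg ?_ fun j _ _ => hW.1 k j)
      (Med_spec hW x k).1.2.2
    refine monotone_filter_right _ fun j _ hj => ?_
    rw [Function.update_self] at hj
    exact hj.trans_le (hle j)
  · refine le_trans (sum_le_sum_of_subset_of_nonneg ?_ fun j _ _ => hW.1 k j)
      ((Med_le_iff hW x k).1 (hx k))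
    refine monotone_filter_right _ fun j _ hj => ?_
    rw [Function.update_of_ne hki] at hj
    exact hj.trans_le (hle j)

theorem sum_update_eq (x : V → ℝ) (i : V) (m : ℝ) :
    ∑ j, Function.update x i m j = ∑ j, x j + (m - x i) := by
  have h := sum_update_of_mem (mem_univ i) x m
  have h' := sum_erase_add univ x (mem_univ i)
  rw [← erase_eq] at h
  linarith

theorem traj_congr (W : V → V → ℝ) {u v : ℕ → V} (x : V → ℝ) {T : ℕ}
    (h : ∀ t < T, u t = v t) : traj W u x T = traj W v x T := by
  induction T with
  | zero => rfl
  | succ T ih =>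
    rw [traj, traj, ih fun t ht => h t (ht.trans T.lt_succ_self), h T T.lt_succ_self]

/-- The states that some finite update sequence reaches from `x`. -/
def reachableStates (W : V → V → ℝ) (x : V → ℝ) : Set (V → ℝ) :=
  {y | ∃ (T : ℕ) (u : ℕ → V), traj W u x T = y}

theorem update_mem_reachableStates {x y : V → ℝ} (hy : y ∈ reachableStates W x) (i : V) :
    Function.update y i (Med W y i) ∈ reachableStates W x := by
  obtain ⟨T, u, rfl⟩ := hy
  refine ⟨T + 1, Function.update u T i, ?_⟩
  rw [traj, Function.update_self,
    traj_congr W x fun t ht => Function.update_of_ne ht.ne i u]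

theorem finite_reachableStates (hW : RowStochastic W) (x : V → ℝ) :
    (reachableStates W x).Finite := by
  refine (Set.Finite.pi' fun _ : V => Set.finite_range x).subset ?_
  rintro _ ⟨T, u, rfl⟩
  induction T with
  | zero => exact fun j => ⟨j, rfl⟩
  | succ T ih =>
    intro j
    rw [traj]
    rcases eq_or_ne j (u T) with rfl | hj
    · obtain ⟨k, hk⟩ := (Med_spec hW (traj W u x T) (u T)).1.1
      rw [Function.update_self, ← hk]
      exact ih k
    · rw [Function.update_of_ne hj]
      exact ih j

end WeightedMedian

/-- from any initial state there is a finite update sequence driving the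
weighted-median opinion dynamics to an equilibrium. -/
theorem exists_update_sequence_to_equilibrium (n : ℕ) (hn : 0 < n)
    (W : Fin n → Fin n → ℝ) (hW : RowStochastic W) (x0 : Fin n → ℝ) :
    ∃ (T : ℕ) (u : ℕ → Fin n), IsEquilibrium W (traj W u x0 T) := by
  have hfin := finite_reachableStates hW x0
  have hx0 : x0 ∈ reachableStates W x0 := ⟨0, fun _ => ⟨0, hn⟩, rfl⟩
  -- A reachable state of maximal sum admits no upward move.
  obtain ⟨y, hy, hymax⟩ := Set.exists_max_image _ (fun y => ∑ j, y j) hfin ⟨x0, hx0⟩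
  have hyup : ∀ k, Med W y k ≤ y k := fun k => by
    have h := hymax _ (update_mem_reachableStates hy k)
    simp only [sum_update_eq] at h
    linarith
  -- Among the reachable states without upward moves, one of minimal sum is an equilibrium.
  obtain ⟨z, ⟨hz, hzup⟩, hzmin⟩ := Set.exists_min_image
    (reachableStates W x0 ∩ {z | ∀ k, Med W z k ≤ z k}) (fun z => ∑ j, z j)
    (hfin.inter_of_left _) ⟨y, hy, hyup⟩
  have heq : IsEquilibrium W z := fun k => by
    have h := hzmin _ ⟨update_mem_reachableStates hz k, Med_update_le hW hzup k⟩
    simp only [sum_update_eq] at h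
    exact le_antisymm (hzup k) (by linarith)
  obtain ⟨T, u, rfl⟩ := hz
  exact ⟨T, u, heq⟩
end

section
/- Given an influence network G(W) on node set V, the following two statements are equivalent: (1) there exists a measurable set X₀ ⊆ ℝ^n with positive Lebesgue measure such that for every x(0) ∈ X₀ there exist T ∈ ℕ and an update sequence i_1, …, i_T along which the trajectory of the weighted-median opinion dynamics is a consensus vector at time T; (2) there exists x₀ ∈ ℝ^n with pairwise distinct entries, T ∈ ℕ, and an update sequence i_1, …, i_T such that the trajectory started from x(0) = x₀ along this sequence is a consensus vector at time T. -/
open Finset MeasureTheory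

/-- Weighted medians are convex within the set of entries: an entry lying between two weighted
medians is a weighted median. -/
theorem IsWMedian.of_between {V : Type*} [Fintype V] {x w : V → ℝ} (hw : ∀ j, 0 ≤ w j)
    {a b : ℝ} (ha : IsWMedian x w a) (hb : IsWMedian x w b) {i : V}
    (hai : a ≤ x i) (hib : x i ≤ b) : IsWMedian x w (x i) := by
  refine ⟨⟨i, rfl⟩, le_trans ?_ hb.2.1, le_trans ?_ ha.2.2⟩
  · refine Finset.sum_le_sum_of_subset_of_nonneg ?_ fun j _ _ => hw j
    exact Finset.monotone_filter_right _ fun j _ h => lt_of_lt_of_le h hib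
  · refine Finset.sum_le_sum_of_subset_of_nonneg ?_ fun j _ _ => hw j
    exact Finset.monotone_filter_right _ fun j _ h => lt_of_le_of_lt hai h

/-- A weighted median of `x` that is closest to `x i` is unique. -/
theorem IsWMedian.closest_unique {V : Type*} [Fintype V] {x w : V → ℝ} (hw : ∀ j, 0 ≤ w j)
    {i : V} {a b : ℝ} (ha : IsWMedian x w a)
    (ha' : ∀ m, IsWMedian x w m → |a - x i| ≤ |m - x i|) (hb : IsWMedian x w b)
    (hb' : ∀ m, IsWMedian x w m → |b - x i| ≤ |m - x i|) : a = b := by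
  have key : IsWMedian x w (x i) → a = b := fun h => by
    have h1 := ha' _ h
    have h2 := hb' _ h
    rw [sub_self, abs_zero, abs_nonpos_iff, sub_eq_zero] at h1 h2
    exact h1.trans h2.symm
  have hab : |a - x i| = |b - x i| := le_antisymm (ha' b hb) (hb' a ha)
  rcases le_total a (x i) with h1 | h1 <;> rcases le_total b (x i) with h2 | h2
  · rw [abs_of_nonpos (by linarith), abs_of_nonpos (by linarith)] at hab
    linarith
  · exact key (ha.of_between hw hb h1 h2)
  · exact key (hb.of_between hw ha h2 h1)
  · rw [abs_of_nonneg (by linarith), abs_of_nonneg (by linarith)] at hab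
    linarith

theorem Med_eq_of_closest {V : Type*} [Fintype V] {W : V → V → ℝ} (hW : ∀ i j, 0 ≤ W i j)
    {x : V → ℝ} {i : V} {m : ℝ} (hm : IsWMedian x (W i) m)
    (hm' : ∀ m', IsWMedian x (W i) m' → |m - x i| ≤ |m' - x i|) : Med W x i = m := by
  have h : ∃ m, IsWMedian x (W i) m ∧ ∀ m', IsWMedian x (W i) m' → |m - x i| ≤ |m' - x i| :=
    ⟨m, hm, hm'⟩
  rw [Med, dif_pos h]
  exact IsWMedian.closest_unique (hW i) h.choose_spec.1 h.choose_spec.2 hm hm'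

theorem exists_closest_isWMedian {V : Type*} [Fintype V] {x w : V → ℝ} (i : V)
    (h : ∃ m, IsWMedian x w m) :
    ∃ m, IsWMedian x w m ∧ ∀ m', IsWMedian x w m' → |m - x i| ≤ |m' - x i| := by
  have hfin : {m | IsWMedian x w m}.Finite :=
    (Set.finite_range x).subset fun m hm => hm.1
  exact Set.exists_min_image _ (fun m => |m - x i|) hfin h

theorem isWMedian_apply_iff_of_lt_iff {V : Type*} [Fintype V] {x y w : V → ℝ}
    (hxy : ∀ j k, x j < x k ↔ y j < y k) (k : V) :
    IsWMedian x w (x k) ↔ IsWMedian y w (y k) := by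
  simp only [IsWMedian, hxy, exists_apply_eq_apply]

/-- Weighted medians with closest-value tie-breaking depend only on the order of the entries. -/
theorem exists_Med_eq_apply {V : Type*} [Fintype V] {W : V → V → ℝ} (hW : ∀ i j, 0 ≤ W i j)
    {x y : V → ℝ} (hxy : ∀ j k, x j < x k ↔ y j < y k) (i : V) :
    ∃ k, Med W x i = x k ∧ Med W y i = y k := by
  by_cases h : ∃ m, IsWMedian x (W i) m
  · obtain ⟨m, hm, hm'⟩ := exists_closest_isWMedian i h
    obtain ⟨k, rfl⟩ := hm.1
    refine ⟨k, Med_eq_of_closest hW hm hm',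
      Med_eq_of_closest hW ((isWMedian_apply_iff_of_lt_iff hxy k).1 hm) fun m' h' => ?_⟩
    obtain ⟨l, rfl⟩ := h'.1
    have hl := (isWMedian_apply_iff_of_lt_iff hxy l).2 h'
    have hle : ∀ j k, x j ≤ x k ↔ y j ≤ y k := fun j k => by
      rw [← not_lt, ← not_lt, hxy]
    have hi : IsWMedian x (W i) (x i) → x k = x i := fun hi => by
      have := hm' _ hi
      rwa [sub_self, abs_zero, abs_nonpos_iff, sub_eq_zero] at this
    have hkl := hm' _ hl
    rcases lt_trichotomy (x k) (x i) with hki | hki | hki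
    · have hli : x l < x i := lt_of_not_ge fun hil =>
        hki.ne (hi (hm.of_between (hW i) hl hki.le hil))
      rw [abs_of_neg (by linarith), abs_of_neg (by linarith)] at hkl
      have h1 := (hle l k).1 (by linarith)
      have h2 := (hxy k i).1 hki
      rw [abs_of_neg (by linarith), abs_of_neg (by linarith)]
      linarith
    · have : y k = y i := le_antisymm ((hle k i).1 hki.le) ((hle i k).1 hki.ge)
      rw [this, sub_self, abs_zero]
      exact abs_nonneg _
    · have hil : x i < x l := lt_of_not_ge fun hli =>
        hki.ne' (hi (hl.of_between (hW i) hm hli hki.le))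
      rw [abs_of_pos (by linarith), abs_of_pos (by linarith)] at hkl
      have h1 := (hle k l).1 (by linarith)
      have h2 := (hxy i k).1 hki
      rw [abs_of_pos (by linarith), abs_of_pos (by linarith)]
      linarith
  · have h' : ¬ ∃ m, IsWMedian y (W i) m := fun ⟨m, hm⟩ => by
      obtain ⟨k, rfl⟩ := hm.1
      exact h ⟨_, (isWMedian_apply_iff_of_lt_iff hxy k).2 hm⟩
    exact ⟨i, dif_neg fun ⟨m, hm⟩ => h ⟨m, hm.1⟩, dif_neg fun ⟨m, hm⟩ => h' ⟨m, hm.1⟩⟩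

/-- Along a common update sequence, trajectories from equally ordered initial states copy the
initial entries in the same pattern. -/
theorem exists_traj_eq_comp {V : Type*} [Fintype V] [DecidableEq V] {W : V → V → ℝ}
    (hW : ∀ i j, 0 ≤ W i j) {x y : V → ℝ} (hxy : ∀ j k, x j < x k ↔ y j < y k) (u : ℕ → V)
    (T : ℕ) : ∃ σ : V → V, traj W u x T = x ∘ σ ∧ traj W u y T = y ∘ σ := by
  induction T with
  | zero => exact ⟨id, rfl, rfl⟩
  | succ t ih =>
    obtain ⟨σ, hx, hy⟩ := ih
    obtain ⟨k, hkx, hky⟩ := exists_Med_eq_apply hW (x := x ∘ σ) (y := y ∘ σ)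
      (fun j k => hxy (σ j) (σ k)) (u t)
    refine ⟨Function.update σ (u t) (σ k), ?_, ?_⟩
    · rw [traj, hx, hkx, Function.comp_update, Function.comp_apply]
    · rw [traj, hy, hky, Function.comp_update, Function.comp_apply]

theorem volume_setOf_not_injective {ι : Type*} [Fintype ι] :
    volume {x : ι → ℝ | ¬ Function.Injective x} = 0 := by
  classical
  have hsub : {x : ι → ℝ | ¬ Function.Injective x} ⊆
      ⋃ p : {p : ι × ι // p.1 ≠ p.2}, {x : ι → ℝ | x p.1.1 = x p.1.2} := fun x hx => by
    simp only [Function.Injective, Set.mem_ofPred_eq, not_forall] at hx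
    obtain ⟨i, j, hij, hne⟩ := hx
    exact Set.mem_iUnion.2 ⟨⟨(i, j), hne⟩, hij⟩
  refine measure_mono_null hsub (measure_iUnion_null fun ⟨⟨i, j⟩, hne⟩ => ?_)
  let S : Submodule ℝ (ι → ℝ) :=
    LinearMap.eqLocus (LinearMap.proj (R := ℝ) (φ := fun _ : ι => ℝ) i) (LinearMap.proj j)
  have hS : S ≠ ⊤ := fun h => by
    have hmem : (Pi.single i 1 : ι → ℝ) ∈ S := h ▸ Submodule.mem_top
    have heq : (Pi.single i 1 : ι → ℝ) i = (Pi.single i 1 : ι → ℝ) j := hmem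
    simp [Pi.single_eq_of_ne (Ne.symm hne)] at heq
  exact Measure.addHaar_submodule volume S hS

theorem isOpen_setOf_forall_lt_imp_lt {ι : Type*} [Finite ι] (x : ι → ℝ) :
    IsOpen {y : ι → ℝ | ∀ j k, x j < x k → y j < y k} := by
  simp only [Set.ofPred_forall]
  exact isOpen_iInter_of_finite fun j => isOpen_iInter_of_finite fun k =>
    isOpen_iInter_of_finite fun _ => isOpen_lt (continuous_apply j) (continuous_apply k)

/-- the existence of a positive-Lebesgue-measure set of initial conditions
from each of which some finite update sequence reaches consensus is equivalent to the
existence of a single initial condition with pairwise distinct entries from which some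
finite update sequence reaches consensus. -/
theorem positive_measure_consensus_iff_distinct_consensus (n : ℕ) (hn : 0 < n)
    (W : Fin n → Fin n → ℝ) (hW : RowStochastic W) :
    (∃ X0 : Set (Fin n → ℝ), MeasurableSet X0 ∧ 0 < volume X0 ∧
        ∀ x0 ∈ X0, ∃ (T : ℕ) (u : ℕ → Fin n),
          ∀ i j, traj W u x0 T i = traj W u x0 T j) ↔
      (∃ x0 : Fin n → ℝ, Function.Injective x0 ∧
        ∃ (T : ℕ) (u : ℕ → Fin n), ∀ i j, traj W u x0 T i = traj W u x0 T j) := by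
  constructor
  · rintro ⟨X0, -, hpos, hX0⟩
    obtain ⟨x, hx, hinj⟩ : ∃ x ∈ X0, Function.Injective x := by
      by_contra! h
      exact hpos.ne' (measure_mono_null h volume_setOf_not_injective)
    exact ⟨x, hinj, hX0 x hx⟩
  · rintro ⟨x, hinj, T, u, hcons⟩
    have hopen := isOpen_setOf_forall_lt_imp_lt x
    refine ⟨_, hopen.measurableSet, hopen.measure_pos volume ⟨x, fun _ _ => id⟩,
      fun y hy => ⟨T, u, fun i j => ?_⟩⟩
    have hxy : ∀ j k, x j < x k ↔ y j < y k := fun j k => by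
      refine ⟨hy j k, fun h => lt_of_not_ge fun hkj => ?_⟩
      rcases hkj.lt_or_eq with hlt | heq
      · exact lt_asymm h (hy k j hlt)
      · exact h.ne (congrArg y (hinj heq.symm))
    obtain ⟨σ, hσx, hσy⟩ := exists_traj_eq_comp hW.1 hxy u T
    have hij := hcons i j
    rw [hσx] at hij
    rw [hσy]
    exact congrArg y (hinj hij)
end
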